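/- Let N ≥ 1 and let β : ℕ → ℕ be nondecreasing with B (2·β k + k + 1) = 0 for every k ≤ N. Then for every n ≥ 0, the coefficient of t^N in the polynomial P (2n+N) equals c₀ times the sum, over all nondecreasing tuples 0 ≤ i_1 ≤ i_2 ≤ ⋯ ≤ i_N ≤ n satisfying additionally i_k ≤ β_k for each 1 ≤ k ≤ N, of (∏_{k=1}^{N} A_{2 i_k + k - 1}) · (∏_{l=0}^{N-1} ∏_{j=i_l}^{i_{l+1}-1} B_{2j+l+1}) · (∏_{j=i_N}^{n-1} B_{2j+N+1}) with i_0 = 0. That is, in the polynomial case the nested sums in the general expression for the solution of the three-term recurrence relation may be truncated at the eigenvalues β_1, …, β_N. -/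

import Mathlib

lemma sub_one_lt_of_mem_interval {N l : ℕ} (h : 1 ≤ l ∧ l ≤ N) : l - 1 < N :=
  Nat.sub_one_lt_of_le h.1 h.2

/-- The tuple `i_1, …, i_N` as a function on `ℕ`, with value `0` outside `1, …, N`. -/
def extendTuple {N M : ℕ} (i : Fin N → Fin (M + 1)) : ℕ → ℕ :=
  fun l => if h : 1 ≤ l ∧ l ≤ N then (i ⟨l - 1, sub_one_lt_of_mem_interval h⟩ : ℕ) else 0

/-- The contribution of the tuple `e 1, …, e N` to the coefficient of `t ^ N` in `P (2n+N)`. -/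
def tupleWeight {R : Type*} [CommRing R] (A B : ℕ → R) (N n : ℕ) (e : ℕ → ℕ) : R :=
  (∏ k ∈ Finset.range N, A (2 * e (k + 1) + k)) *
    (∏ l ∈ Finset.range N, ∏ j ∈ Finset.Ico (e l) (e (l + 1)), B (2 * j + l + 1)) *
    (∏ j ∈ Finset.Ico (e N) n, B (2 * j + N + 1))

section Tuples

variable {N M : ℕ}

lemma extendTuple_snoc_of_le (i : Fin N → Fin (M + 1)) (x : Fin (M + 1)) {l : ℕ} (hl : l ≤ N) :
    extendTuple (Fin.snoc i x : Fin (N + 1) → Fin (M + 1)) l = extendTuple i l := by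
  unfold extendTuple
  by_cases h : 1 ≤ l
  · have h' : l - 1 < N := by omega
    rw [dif_pos ⟨h, by omega⟩, dif_pos ⟨h, hl⟩]
    simp [Fin.snoc, h']
  · rw [dif_neg (by omega), dif_neg (by omega)]

lemma extendTuple_snoc_last (i : Fin N → Fin (M + 1)) (x : Fin (M + 1)) :
    extendTuple (Fin.snoc i x : Fin (N + 1) → Fin (M + 1)) (N + 1) = x := by
  simp [extendTuple, Fin.snoc]

lemma tupleWeight_congr {R : Type*} [CommRing R] (A B : ℕ → R) (n : ℕ) {e e' : ℕ → ℕ}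
    (h : ∀ l ≤ N, e l = e' l) : tupleWeight A B N n e = tupleWeight A B N n e' := by
  unfold tupleWeight
  rw [h N le_rfl]
  congr 2
  · refine Finset.prod_congr rfl fun k hk => ?_
    rw [h _ (Finset.mem_range.mp hk)]
  · refine Finset.prod_congr rfl fun l hl => ?_
    rw [h _ (Finset.mem_range.mp hl), h _ (Finset.mem_range.mp hl).le]

lemma tupleWeight_succ {R : Type*} [CommRing R] (A B : ℕ → R) (n : ℕ) (e : ℕ → ℕ) :
    tupleWeight A B (N + 1) n e =
      tupleWeight A B N (e (N + 1)) e * A (2 * e (N + 1) + N) *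
        ∏ j ∈ Finset.Ico (e (N + 1)) n, B (2 * j + (N + 1) + 1) := by
  simp only [tupleWeight, Finset.prod_range_succ]
  ring

/-- Nondecreasing tuples bounded by `n` and, entrywise, by `β`. -/
def IsTruncatedTuple (β : ℕ → ℕ) (n : ℕ) (i : Fin N → Fin (M + 1)) : Prop :=
  (∀ a b, a ≤ b → i a ≤ i b) ∧ (∀ k : Fin N, (i k : ℕ) ≤ β ((k : ℕ) + 1)) ∧
    ∀ k, (i k : ℕ) ≤ n

lemma isTruncatedTuple_snoc (β : ℕ → ℕ) (n : ℕ) (i : Fin N → Fin (M + 1)) (x : Fin (M + 1)) :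
    IsTruncatedTuple β n (Fin.snoc i x : Fin (N + 1) → Fin (M + 1)) ↔
      ((x : ℕ) ≤ n ∧ (x : ℕ) ≤ β (N + 1)) ∧ IsTruncatedTuple β x i := by
  simp only [IsTruncatedTuple, Fin.forall_fin_succ', Fin.snoc_castSucc, Fin.snoc_last,
    Fin.val_castSucc, Fin.val_last, le_refl, forall_true_left, Fin.le_def, and_true]
  constructor
  · rintro ⟨⟨h, -⟩, ⟨hb, hx⟩, -, hn⟩
    exact ⟨⟨hn, hx⟩, fun a => (h a).1, hb, fun a => (h a).2 a.isLt.le⟩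
  · rintro ⟨⟨hn, hx⟩, h, hb, hle⟩
    refine ⟨⟨fun a => ⟨h a, fun _ => hle a⟩, fun a ha => ?_⟩, ⟨hb, hx⟩, fun a => (hle a).trans hn, hn⟩
    have := a.isLt
    omega

open Classical in
lemma sum_tupleWeight_succ {R : Type*} [CommRing R] (A B : ℕ → R) (β : ℕ → ℕ) {n : ℕ}
    (hn : n ≤ M) :
    ∑ i : Fin (N + 1) → Fin (M + 1) with IsTruncatedTuple β n i,
        tupleWeight A B (N + 1) n (extendTuple i) =
      ∑ x ∈ Finset.range (n + 1) with x ≤ β (N + 1),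
        (∑ i : Fin N → Fin (M + 1) with IsTruncatedTuple β x i,
          tupleWeight A B N x (extendTuple i)) * A (2 * x + N) *
          ∏ j ∈ Finset.Ico x n, B (2 * j + (N + 1) + 1) := by
  have hrange : (Finset.range (n + 1)).filter (· ≤ β (N + 1)) =
      (Finset.range (M + 1)).filter (fun x => x ≤ n ∧ x ≤ β (N + 1)) := by
    ext x
    simp only [Finset.mem_filter, Finset.mem_range]
    omega
  rw [hrange, Finset.sum_filter, Finset.sum_filter, Finset.sum_range,
    ← (Fin.snocEquiv fun _ => Fin (M + 1)).sum_comp, Fintype.sum_prod_type]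
  refine Finset.sum_congr rfl fun x _ => ?_
  simp only [Fin.snocEquiv, Equiv.coe_fn_mk, isTruncatedTuple_snoc, tupleWeight_succ,
    extendTuple_snoc_last]
  split_ifs with h
  · rw [Finset.sum_filter, Finset.sum_mul, Finset.sum_mul]
    refine Finset.sum_congr rfl fun i _ => ?_
    rw [tupleWeight_congr A B (x : ℕ) fun l hl => extendTuple_snoc_of_le i x hl]
    by_cases hi : IsTruncatedTuple β x i <;> simp [h, hi]
  · simp [h]

end Tuples

section Recurrence

variable {R : Type*} [CommRing R] {A B : ℕ → R} {c₀ : R} {P : ℕ → Polynomial R}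
  (h0 : P 0 = Polynomial.C c₀)
  (h1 : P 1 = Polynomial.X * Polynomial.C (A 0 * c₀))
  (hrec : ∀ n, 1 ≤ n →
    P (n + 1) = Polynomial.X * Polynomial.C (A n) * P n + Polynomial.C (B n) * P (n - 1))

include hrec in
lemma coeff_zero_add_two (m : ℕ) : (P (m + 2)).coeff 0 = B (m + 1) * (P m).coeff 0 := by
  rw [hrec (m + 1) (by omega)]
  simp [mul_assoc]

include hrec in
lemma coeff_succ_add_two (m k : ℕ) :
    (P (m + 2)).coeff (k + 1) =
      A (m + 1) * (P (m + 1)).coeff k + B (m + 1) * (P m).coeff (k + 1) := by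
  rw [hrec (m + 1) (by omega)]
  simp [mul_assoc]

include h0 h1 hrec in
lemma coeff_eq_zero_of_index_lt (m : ℕ) : ∀ k, m < k → (P m).coeff k = 0 := by
  induction m using Nat.twoStepInduction with
  | zero =>
    intro k hk
    rw [h0, Polynomial.coeff_C_of_ne_zero hk.ne']
  | one =>
    intro k hk
    obtain ⟨k, rfl⟩ := Nat.exists_eq_add_of_lt hk
    rw [h1, Polynomial.coeff_X_mul, Polynomial.coeff_C_of_ne_zero (by omega)]
  | more m ih ih' =>
    rintro (_ | k) hk
    · omega
    · rw [coeff_succ_add_two hrec, ih' k (by omega), ih (k + 1) (by omega), mul_zero, mul_zero,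
        add_zero]

include h0 hrec in
lemma coeff_zero_eq_prod (n : ℕ) :
    (P (2 * n)).coeff 0 = c₀ * ∏ j ∈ Finset.range n, B (2 * j + 1) := by
  induction n with
  | zero => simp [h0]
  | succ n ih =>
    rw [show 2 * (n + 1) = 2 * n + 2 by ring, coeff_zero_add_two hrec, ih,
      Finset.prod_range_succ]
    ring

include h0 h1 hrec in
lemma coeff_succ_eq_sum (N n : ℕ) :
    (P (2 * n + (N + 1))).coeff (N + 1) =
      ∑ x ∈ Finset.range (n + 1), (P (2 * x + N)).coeff N * A (2 * x + N) *
        ∏ j ∈ Finset.Ico x n, B (2 * j + (N + 1) + 1) := by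
  induction n with
  | zero =>
    rcases N with _ | N
    · simp [h0, h1, mul_comm]
    · have := coeff_succ_add_two hrec N (N + 1)
      rw [coeff_eq_zero_of_index_lt h0 h1 hrec N _ (by omega)] at this
      simpa [mul_comm] using this
  | succ n ih =>
    rw [show 2 * (n + 1) + (N + 1) = 2 * n + (N + 1) + 2 by ring, coeff_succ_add_two hrec, ih,
      Finset.sum_range_succ _ (n + 1), Finset.mul_sum, add_comm]
    congr 1
    · refine Finset.sum_congr rfl fun x hx => ?_
      rw [Finset.prod_Ico_succ_top (by simpa [Nat.lt_succ_iff] using hx)]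
      ring
    · rw [show 2 * n + (N + 1) + 1 = 2 * (n + 1) + N by ring]
      simp [mul_comm]

variable {β : ℕ → ℕ} (hβmono : Monotone β)

include h0 h1 hrec hβmono in
lemma coeff_eq_zero_of_eigenvalue_lt (N : ℕ) (hβ : ∀ k ≤ N, B (2 * β k + k + 1) = 0) :
    ∀ n, β N < n → (P (2 * n + N)).coeff N = 0 := by
  induction N with
  | zero =>
    intro n hn
    rw [add_zero, coeff_zero_eq_prod h0 hrec,
      Finset.prod_eq_zero (Finset.mem_range.mpr hn) (by simpa using hβ 0 le_rfl), mul_zero]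
  | succ N ih =>
    intro n hn
    rw [coeff_succ_eq_sum h0 h1 hrec]
    refine Finset.sum_eq_zero fun x _ => ?_
    by_cases hx : β N < x
    · rw [ih (fun k hk => hβ k (by omega)) x hx, zero_mul, zero_mul]
    · have := hβmono (Nat.le_succ N)
      rw [Finset.prod_eq_zero (Finset.mem_Ico.mpr ⟨(not_lt.mp hx).trans this, hn⟩)
        (hβ (N + 1) le_rfl), mul_zero]

open Classical in
include h0 h1 hrec hβmono in
lemma coeff_eq_sum_tupleWeight (M N : ℕ) (hβ : ∀ k ≤ N, B (2 * β k + k + 1) = 0) :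
    ∀ n ≤ M, (P (2 * n + N)).coeff N =
      c₀ * ∑ i : Fin N → Fin (M + 1) with IsTruncatedTuple β n i,
        tupleWeight A B N n (extendTuple i) := by
  induction N with
  | zero =>
    intro n _
    rw [add_zero, coeff_zero_eq_prod h0 hrec]
    simp [IsTruncatedTuple, tupleWeight, extendTuple]
  | succ N ih =>
    intro n hn
    have hβ' : ∀ k ≤ N, B (2 * β k + k + 1) = 0 := fun k hk => hβ k (by omega)
    rw [sum_tupleWeight_succ A B β hn, coeff_succ_eq_sum h0 h1 hrec, Finset.mul_sum,
      Finset.sum_filter]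
    refine Finset.sum_congr rfl fun x hx => ?_
    split_ifs with h
    · rw [ih hβ' x (by have := Finset.mem_range.mp hx; omega)]
      ring
    · have := hβmono (Nat.le_succ N)
      rw [coeff_eq_zero_of_eigenvalue_lt h0 h1 hrec hβmono N hβ' x
        (this.trans_lt (not_le.mp h)), zero_mul, zero_mul]

end Recurrence


/-- Polynomial case: with `N ≥ 1` and nondecreasing eigenvalues `β` terminating the `B`-terms
(`B (2 * β k + k + 1) = 0` for `k ≤ N`), the coefficient of `t^N` in `P (2n+N)` equals `c₀`
times the sum over all nondecreasing tuples `0 ≤ i_1 ≤ ⋯ ≤ i_N ≤ n` with `i_k ≤ β k` for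
`1 ≤ k ≤ N` of
`(∏_{k=1}^{N} A (2 i_k + k - 1)) * (∏_{l=0}^{N-1} ∏_{j=i_l}^{i_{l+1}-1} B (2j+l+1)) *
 (∏_{j=i_N}^{n-1} B (2j+N+1))` with the convention `i_0 = 0`. -/
theorem three_term_recurrence_polynomial_truncated_sum
    {R : Type*} [CommRing R] (A B : ℕ → R) (c₀ : R) (P : ℕ → Polynomial R)
    (h0 : P 0 = Polynomial.C c₀)
    (h1 : P 1 = Polynomial.X * Polynomial.C (A 0 * c₀))
    (hrec : ∀ n, 1 ≤ n →
      P (n + 1) = Polynomial.X * Polynomial.C (A n) * P n + Polynomial.C (B n) * P (n - 1))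
    (N : ℕ) (hN : 1 ≤ N) (β : ℕ → ℕ) (hβmono : Monotone β)
    (hβ : ∀ k ≤ N, B (2 * β k + k + 1) = 0)
    (n : ℕ) :
    (P (2 * n + N)).coeff N =
      c₀ * ∑ i ∈ Finset.univ.filter
          (fun i : Fin N → Fin (n + 1) =>
            (∀ a b, a ≤ b → i a ≤ i b) ∧ ∀ k : Fin N, (i k : ℕ) ≤ β ((k : ℕ) + 1)),
        (fun e : ℕ → ℕ =>
          (∏ k ∈ Finset.range N, A (2 * e (k + 1) + k)) *
          (∏ l ∈ Finset.range N, ∏ j ∈ Finset.Ico (e l) (e (l + 1)), B (2 * j + l + 1)) *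
          (∏ j ∈ Finset.Ico (e N) n, B (2 * j + N + 1)))
        (fun l => if h : 1 ≤ l ∧ l ≤ N then (i ⟨l - 1, by omega⟩ : ℕ) else 0) := by
  classical
  rw [coeff_eq_sum_tupleWeight h0 h1 hrec hβmono n N hβ n le_rfl]
  congr 1
  refine Finset.sum_congr (Finset.filter_congr fun i _ => ?_) fun i _ => rfl
  simp only [IsTruncatedTuple, Nat.le_of_lt_succ (i _).isLt, implies_true, and_true]
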